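/- arXiv:2501.16142 — 9 statements merged into one kernel-verified Lean document; each statement's English description precedes it below -/
import Mathlib

section
/- Fix a step size α : ℝ with α ≠ 0. Assume the k×k matrix Zᵀ * Z is invertible and that the series ∑_{t=0}^∞ γ^t • W_p^t of k×k matrices is summable, and define the model-based solution w_mb = (∑'_{t} γ^t • W_p^t) *ᵥ w_r. Then w_mb is the unique fixed point of the semi-gradient TD update; that is, the fixed point of the model-free (semi-gradient TD) approach and the solution of the model-based approach coincide. -/
open Matrix

/-- The semi-gradient TD direction is the Gram matrix applied to the residual of the model-based
linear system. -/
theorem transpose_mulVec_td_error {n k : Type*} [Fintype n] [Fintype k] [DecidableEq k]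
    (Z Z' : Matrix n k ℝ) (R : n → ℝ) (γ : ℝ) (hZZ : IsUnit (Zᵀ * Z)) (w : k → ℝ) :
    Zᵀ *ᵥ (Z *ᵥ w - (R + γ • (Z' *ᵥ w))) =
      (Zᵀ * Z) *ᵥ ((1 - γ • ((Zᵀ * Z)⁻¹ * (Zᵀ * Z'))) *ᵥ w -
        (Zᵀ * Z)⁻¹ *ᵥ (Zᵀ *ᵥ R)) := by
  have hdet : IsUnit (Zᵀ * Z).det := (isUnit_iff_isUnit_det _).1 hZZ
  rw [mulVec_sub, mulVec_sub, mulVec_mulVec _ (Zᵀ * Z), mulVec_mulVec _ (Zᵀ * Z),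
    mul_nonsing_inv _ hdet, one_mulVec, Matrix.mul_sub, Matrix.mul_one, Matrix.mul_smul,
    mul_nonsing_inv_cancel_left _ _ hdet, sub_mulVec, smul_mulVec, mulVec_add, mulVec_smul,
    mulVec_mulVec, mulVec_mulVec]
  abel

/-- The zeros of the semi-gradient TD direction are the solutions of the model-based linear
system. -/
theorem transpose_mulVec_td_error_eq_zero_iff {n k : Type*} [Fintype n] [Fintype k]
    [DecidableEq k] (Z Z' : Matrix n k ℝ) (R : n → ℝ) (γ : ℝ) (hZZ : IsUnit (Zᵀ * Z))
    (w : k → ℝ) :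
    Zᵀ *ᵥ (Z *ᵥ w - (R + γ • (Z' *ᵥ w))) = 0 ↔
      (1 - γ • ((Zᵀ * Z)⁻¹ * (Zᵀ * Z'))) *ᵥ w = (Zᵀ * Z)⁻¹ *ᵥ (Zᵀ *ᵥ R) := by
  rw [transpose_mulVec_td_error Z Z' R γ hZZ w, ← sub_eq_zero (b := (Zᵀ * Z)⁻¹ *ᵥ (Zᵀ *ᵥ R))]
  exact (mulVec_injective_of_isUnit hZZ).eq_iff' (mulVec_zero _)

/-- The fixed point of the model-free (semi-gradient TD) approach and the solution of the
model-based approach coincide: the model-based solution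
`w_mb = (∑' t, γ ^ t • W_p ^ t) *ᵥ w_r` is the unique fixed point of the
semi-gradient TD update `w ↦ w - α • (Zᵀ *ᵥ (Z *ᵥ w - (R + γ • (Z' *ᵥ w))))`. -/
theorem model_free_model_based_same_solution
    {n k : ℕ} (Z Z' : Matrix (Fin n) (Fin k) ℝ) (R : Fin n → ℝ)
    (γ : ℝ) (hγ0 : 0 ≤ γ) (hγ1 : γ < 1)
    (α : ℝ) (hα : α ≠ 0)
    (hZZ : IsUnit (Zᵀ * Z))
    (hsum : Summable fun t : ℕ => γ ^ t • ((Zᵀ * Z)⁻¹ * (Zᵀ * Z')) ^ t) :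
    let W_p : Matrix (Fin k) (Fin k) ℝ := (Zᵀ * Z)⁻¹ * (Zᵀ * Z')
    let w_r : Fin k → ℝ := (Zᵀ * Z)⁻¹ *ᵥ (Zᵀ *ᵥ R)
    let w_mb : Fin k → ℝ := (∑' t : ℕ, γ ^ t • W_p ^ t) *ᵥ w_r
    let td : (Fin k → ℝ) → (Fin k → ℝ) :=
      fun w => w - α • (Zᵀ *ᵥ (Z *ᵥ w - (R + γ • (Z' *ᵥ w))))
    td w_mb = w_mb ∧ ∀ w : Fin k → ℝ, td w = w → w = w_mb := by
  intro W_p w_r w_mb td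
  have htd (w : Fin k → ℝ) : td w = w ↔ (1 - γ • W_p) *ᵥ w = w_r := by
    rw [← transpose_mulVec_td_error_eq_zero_iff Z Z' R γ hZZ w]
    simp [td, hα]
  have hpow : Summable fun t : ℕ => (γ • W_p) ^ t := by
    simpa only [smul_pow] using hsum
  have hw_mb : w_mb = (∑' t : ℕ, (γ • W_p) ^ t) *ᵥ w_r := by
    simp only [w_mb, smul_pow]
  refine ⟨?_, fun w hw => ?_⟩
  · rw [htd, hw_mb, mulVec_mulVec, hpow.one_sub_mul_tsum_pow, one_mulVec]
  · rw [hw_mb, ← (htd w).1 hw, mulVec_mulVec, hpow.tsum_pow_mul_one_sub, one_mulVec]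
end

section
/- Assume the k×k matrix Zᵀ * Z is invertible and that the k×k matrix 1 - γ • W_p is invertible. Then the matrix Zᵀ * Z - γ • (Zᵀ * Z') is invertible, and (Zᵀ * Z - γ • (Zᵀ * Z'))⁻¹ *ᵥ (Zᵀ *ᵥ R) = (1 - γ • W_p)⁻¹ *ᵥ w_r; equivalently, (Zᵀ * Z - γ • (Zᵀ * Z')) *ᵥ ((1 - γ • W_p)⁻¹ *ᵥ w_r) = Zᵀ *ᵥ R. -/
open Matrix

/-- If `Zᵀ * Z` is invertible and `1 - γ • W_p` is invertible (where
`W_p = (Zᵀ * Z)⁻¹ * (Zᵀ * Z')` and `w_r = (Zᵀ * Z)⁻¹ *ᵥ (Zᵀ *ᵥ R)`), then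
`Zᵀ * Z - γ • (Zᵀ * Z')` is invertible and
`(Zᵀ * Z - γ • (Zᵀ * Z'))⁻¹ *ᵥ (Zᵀ *ᵥ R) = (1 - γ • W_p)⁻¹ *ᵥ w_r`; equivalently,
`(Zᵀ * Z - γ • (Zᵀ * Z')) *ᵥ ((1 - γ • W_p)⁻¹ *ᵥ w_r) = Zᵀ *ᵥ R`. -/
theorem model_based_solution_solves_TD_linear_system
    {n k : ℕ} (Z Z' : Matrix (Fin n) (Fin k) ℝ) (R : Fin n → ℝ)
    (γ : ℝ) (hγ0 : 0 ≤ γ) (hγ1 : γ < 1)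
    (hZZ : IsUnit (Zᵀ * Z))
    (hW : IsUnit (1 - γ • ((Zᵀ * Z)⁻¹ * (Zᵀ * Z')))) :
    let W_p : Matrix (Fin k) (Fin k) ℝ := (Zᵀ * Z)⁻¹ * (Zᵀ * Z')
    let w_r : Fin k → ℝ := (Zᵀ * Z)⁻¹ *ᵥ (Zᵀ *ᵥ R)
    IsUnit (Zᵀ * Z - γ • (Zᵀ * Z')) ∧
      (Zᵀ * Z - γ • (Zᵀ * Z'))⁻¹ *ᵥ (Zᵀ *ᵥ R) = (1 - γ • W_p)⁻¹ *ᵥ w_r ∧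
      (Zᵀ * Z - γ • (Zᵀ * Z')) *ᵥ ((1 - γ • W_p)⁻¹ *ᵥ w_r) = Zᵀ *ᵥ R := by
  intro W_p w_r
  have hfactor : Zᵀ * Z - γ • (Zᵀ * Z') = (Zᵀ * Z) * (1 - γ • W_p) := by
    rw [mul_sub, mul_one, mul_smul_comm,
      mul_nonsing_inv_cancel_left _ _ ((isUnit_iff_isUnit_det _).mp hZZ)]
  have hinv : (Zᵀ * Z - γ • (Zᵀ * Z'))⁻¹ *ᵥ (Zᵀ *ᵥ R) = (1 - γ • W_p)⁻¹ *ᵥ w_r := by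
    rw [hfactor, Matrix.mul_inv_rev, ← mulVec_mulVec]
  have hunit : IsUnit (Zᵀ * Z - γ • (Zᵀ * Z')) := hfactor ▸ hZZ.mul hW
  refine ⟨hunit, hinv, ?_⟩
  rw [← hinv, mulVec_mulVec, mul_nonsing_inv _ ((isUnit_iff_isUnit_det _).mp hunit), one_mulVec]
end

section
/- The matrix 1 - γ • P is invertible, and for every reward vector r̄ : ι → ℝ there is a unique Q : ι → ℝ satisfying the Bellman equation Q = r̄ + γ • (P *ᵥ Q), namely Q = (1 - γ • P)⁻¹ *ᵥ r̄. -/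
open Matrix

/-- For a row-stochastic matrix `P` and `0 ≤ γ < 1`, the matrix `1 - γ • P` is strictly
diagonally dominant, hence invertible. -/
theorem isUnit_one_sub_smul_of_rowStochastic {ι : Type*} [Fintype ι] [DecidableEq ι]
    {P : Matrix ι ι ℝ} (hP0 : ∀ i j, 0 ≤ P i j) (hP1 : ∀ i, ∑ j, P i j = 1)
    {γ : ℝ} (hγ0 : 0 ≤ γ) (hγ1 : γ < 1) : IsUnit (1 - γ • P) := by
  rw [Matrix.isUnit_iff_isUnit_det, isUnit_iff_ne_zero]
  refine det_ne_zero_of_sum_row_lt_diag fun k => ?_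
  have hoff : ∑ j ∈ Finset.univ.erase k, ‖(1 - γ • P) k j‖ =
      γ * ∑ j ∈ Finset.univ.erase k, P k j := by
    rw [Finset.mul_sum]
    refine Finset.sum_congr rfl fun j hj => ?_
    simp [Matrix.one_apply_ne (Finset.ne_of_mem_erase hj).symm, abs_of_nonneg hγ0,
      abs_of_nonneg (hP0 k j)]
  have hsum := Finset.add_sum_erase Finset.univ (P k) (Finset.mem_univ k)
  rw [hP1 k] at hsum
  calc ∑ j ∈ Finset.univ.erase k, ‖(1 - γ • P) k j‖ = γ - γ * P k k := by
        rw [hoff]; linear_combination γ * hsum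
    _ < (1 - γ • P) k k := by simp [hγ1]
    _ ≤ ‖(1 - γ • P) k k‖ := Real.le_norm_self _

/-- For a policy-induced transition matrix `P` (entrywise nonnegative, rows summing to `1`)
and discount factor `0 ≤ γ < 1`, the matrix `1 - γ • P` is invertible, and for every reward
vector `rbar` there is a unique solution `Q` of the Bellman equation `Q = rbar + γ • (P *ᵥ Q)`,
namely `Q = (1 - γ • P)⁻¹ *ᵥ rbar`. -/
theorem bellman_equation_unique_solution
    {ι : Type*} [Fintype ι] [Nonempty ι] [DecidableEq ι]
    (P : Matrix ι ι ℝ) (hP0 : ∀ i j, 0 ≤ P i j) (hP1 : ∀ i, ∑ j, P i j = 1)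
    (γ : ℝ) (hγ0 : 0 ≤ γ) (hγ1 : γ < 1) :
    IsUnit (1 - γ • P) ∧
      ∀ rbar : ι → ℝ, ∀ Q : ι → ℝ,
        Q = rbar + γ • (P *ᵥ Q) ↔ Q = (1 - γ • P)⁻¹ *ᵥ rbar := by
  have hU := isUnit_one_sub_smul_of_rowStochastic hP0 hP1 hγ0 hγ1
  have hdet := (Matrix.isUnit_iff_isUnit_det _).mp hU
  refine ⟨hU, fun rbar Q => ?_⟩
  have hbellman : Q = rbar + γ • (P *ᵥ Q) ↔ (1 - γ • P) *ᵥ Q = rbar := by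
    rw [Matrix.sub_mulVec, Matrix.one_mulVec, Matrix.smul_mulVec, sub_eq_iff_eq_add]
  rw [hbellman]
  constructor
  · rintro rfl
    rw [Matrix.mulVec_mulVec, Matrix.nonsing_inv_mul _ hdet, Matrix.one_mulVec]
  · rintro rfl
    rw [Matrix.mulVec_mulVec, Matrix.mul_nonsing_inv _ hdet, Matrix.one_mulVec]
end

section
/- Let k : ℕ, let Z : Matrix ι (Fin k) ℝ (whose row at i is the feature vector of state–action pair i), let W_p : Matrix (Fin k) (Fin k) ℝ, and let w_r, w : Fin k → ℝ satisfy w = w_r + γ • (W_p *ᵥ w). Let Q^π : ι → ℝ satisfy the Bellman equation Q^π = r̄ + γ • (P *ᵥ Q^π), define the approximate value function Q = Z *ᵥ w and the value error VE = Q - Q^π. Then for every i : ι, |VE i| ≤ (1 - γ)⁻¹ * max_{j : ι} ( |(Z *ᵥ w_r) j - r̄ j| + (max_{l : Fin k} |w l|) * ∑_{l : Fin k} |(Z * W_p) j l - (P * Z) j l| ); that is, the value error is bounded by the accuracy of the estimated dynamics and reward. -/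
open Matrix

/-- A row-stochastic matrix does not increase a uniform bound on the entries of a vector. -/
theorem abs_mulVec_le_of_row_stochastic {ι : Type*} [Fintype ι]
    {P : Matrix ι ι ℝ} (hP0 : ∀ i j, 0 ≤ P i j) (hP1 : ∀ i, ∑ j, P i j = 1)
    {v : ι → ℝ} {M : ℝ} (hv : ∀ j, |v j| ≤ M) (i : ι) : |(P *ᵥ v) i| ≤ M :=
  calc |(P *ᵥ v) i| ≤ ∑ j, |P i j * v j| := Finset.abs_sum_le_sum_abs _ _
    _ ≤ ∑ j, P i j * M := by
      gcongr with j
      rw [abs_mul, abs_of_nonneg (hP0 i j)]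
      exact mul_le_mul_of_nonneg_left (hv j) (hP0 i j)
    _ = M := by rw [← Finset.sum_mul, hP1, one_mul]

/-- A vector that is a discounted row-stochastic average of itself up to an error `c` is bounded
by `(1 - γ)⁻¹ * c`. -/
theorem abs_le_of_abs_le_add_mul_abs_mulVec {ι : Type*} [Fintype ι]
    {P : Matrix ι ι ℝ} (hP0 : ∀ i j, 0 ≤ P i j) (hP1 : ∀ i, ∑ j, P i j = 1)
    {γ : ℝ} (hγ0 : 0 ≤ γ) (hγ1 : γ < 1) {v : ι → ℝ} {c : ℝ}
    (hv : ∀ j, |v j| ≤ c + γ * |(P *ᵥ v) j|) (i : ι) : |v i| ≤ (1 - γ)⁻¹ * c := by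
  have : Nonempty ι := ⟨i⟩
  obtain ⟨m, hm⟩ := Finite.exists_max fun j => |v j|
  have hPm := mul_le_mul_of_nonneg_left (abs_mulVec_le_of_row_stochastic hP0 hP1 hm m) hγ0
  rw [inv_mul_eq_div, le_div_iff₀ (sub_pos.2 hγ1)]
  have hi := mul_le_mul_of_nonneg_right (hm i) (sub_pos.2 hγ1).le
  linarith [hv m]

/-- Hölder's inequality for the `ℓ¹` norm of a row and the sup norm of a vector. -/
theorem abs_mulVec_le_iSup_mul_sum {ι κ : Type*} [Fintype κ] (A : Matrix ι κ ℝ) (w : κ → ℝ)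
    (i : ι) : |(A *ᵥ w) i| ≤ (⨆ l, |w l|) * ∑ l, |A i l| :=
  calc |(A *ᵥ w) i| ≤ ∑ l, |A i l * w l| := Finset.abs_sum_le_sum_abs _ _
    _ ≤ ∑ l, (⨆ l, |w l|) * |A i l| := by
      gcongr with l
      rw [abs_mul, mul_comm]
      exact mul_le_mul_of_nonneg_right
        (le_ciSup (f := fun l => |w l|) (Set.finite_range _).bddAbove l) (abs_nonneg _)
    _ = _ := (Finset.mul_sum ..).symm

/-- Value-error bound: if `w = w_r + γ • (W_p *ᵥ w)` and `Qπ` solves the Bellman equation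
`Qπ = rbar + γ • (P *ᵥ Qπ)`, then the value error `VE = Z *ᵥ w - Qπ` of the approximate
value function `Q = Z *ᵥ w` satisfies, for every state–action pair `i`,
`|VE i| ≤ (1 - γ)⁻¹ * max_j (|(Z *ᵥ w_r) j - rbar j| + (max_l |w l|) * ∑ l, |(Z * W_p) j l - (P * Z) j l|)`,
i.e. the value error is bounded by the accuracy of the estimated dynamics and reward. -/
theorem value_error_bound
    {ι : Type*} [Fintype ι] [Nonempty ι]
    (P : Matrix ι ι ℝ) (hP0 : ∀ i j, 0 ≤ P i j) (hP1 : ∀ i, ∑ j, P i j = 1)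
    (rbar : ι → ℝ) (γ : ℝ) (hγ0 : 0 ≤ γ) (hγ1 : γ < 1)
    {k : ℕ} (Z : Matrix ι (Fin k) ℝ) (W_p : Matrix (Fin k) (Fin k) ℝ)
    (w_r w : Fin k → ℝ) (hw : w = w_r + γ • (W_p *ᵥ w))
    (Qπ : ι → ℝ) (hQπ : Qπ = rbar + γ • (P *ᵥ Qπ)) :
    let VE : ι → ℝ := Z *ᵥ w - Qπ
    ∀ i : ι, |VE i| ≤ (1 - γ)⁻¹ *
      ⨆ j : ι, (|(Z *ᵥ w_r) j - rbar j| +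
        (⨆ l : Fin k, |w l|) * ∑ l : Fin k, |(Z * W_p) j l - (P * Z) j l|) := by
  intro VE
  have hVE : VE = (Z *ᵥ w_r - rbar) + γ • ((Z * W_p - P * Z) *ᵥ w) + γ • (P *ᵥ VE) := by
    have hZ : Z *ᵥ w = Z *ᵥ w_r + γ • ((Z * W_p) *ᵥ w) := by
      conv_lhs => rw [hw]
      rw [mulVec_add, mulVec_smul, mulVec_mulVec]
    have hP : P *ᵥ VE = (P * Z) *ᵥ w - P *ᵥ Qπ := by
      rw [mulVec_sub, mulVec_mulVec]
    rw [hP, sub_mulVec]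
    change Z *ᵥ w - Qπ = _
    conv_lhs => rw [hZ, hQπ]
    module
  refine abs_le_of_abs_le_add_mul_abs_mulVec hP0 hP1 hγ0 hγ1 fun j => ?_
  have hA : |((Z * W_p - P * Z) *ᵥ w) j| ≤
      (⨆ l, |w l|) * ∑ l, |(Z * W_p) j l - (P * Z) j l| :=
    abs_mulVec_le_iSup_mul_sum (Z * W_p - P * Z) w j
  calc |VE j|
      = |((Z *ᵥ w_r) j - rbar j) + γ * ((Z * W_p - P * Z) *ᵥ w) j + γ * (P *ᵥ VE) j| :=
        congrArg abs (congrFun hVE j)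
    _ ≤ |(Z *ᵥ w_r) j - rbar j| + γ * |((Z * W_p - P * Z) *ᵥ w) j| + γ * |(P *ᵥ VE) j| := by
      refine (abs_add_three _ _ _).trans_eq ?_
      rw [abs_mul, abs_mul, abs_of_nonneg hγ0]
    _ ≤ (|(Z *ᵥ w_r) j - rbar j| + (⨆ l, |w l|) * ∑ l, |(Z * W_p) j l - (P * Z) j l|)
          + γ * |(P *ᵥ VE) j| := by
      linarith [(mul_le_of_le_one_left (abs_nonneg _) hγ1.le).trans hA]
    _ ≤ _ := by
      gcongr
      exact le_ciSup (f := fun j => |(Z *ᵥ w_r) j - rbar j| +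
        (⨆ l, |w l|) * ∑ l, |(Z * W_p) j l - (P * Z) j l|) (Set.finite_range _).bddAbove j
end

section
/- Let k : ℕ, let Z : Matrix ι (Fin k) ℝ (whose row at i is the feature vector of state–action pair i), let W_p : Matrix (Fin k) (Fin k) ℝ, and let w_r, w : Fin k → ℝ satisfy w = w_r + γ • (W_p *ᵥ w). Let Q^π : ι → ℝ satisfy the Bellman equation Q^π = r̄ + γ • (P *ᵥ Q^π), define the approximate value function Q = Z *ᵥ w and the value error VE = Q - Q^π. Then the value error satisfies the one-step recursion VE = (Z *ᵥ w_r - r̄) + γ • ((Z * W_p - P * Z) *ᵥ w) + γ • (P *ᵥ VE). -/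
open Matrix

/-- One-step recursion for the value error: if `w = w_r + γ • (W_p *ᵥ w)` and `Qπ` solves
the Bellman equation `Qπ = rbar + γ • (P *ᵥ Qπ)`, then the value error `VE = Z *ᵥ w - Qπ`
satisfies `VE = (Z *ᵥ w_r - rbar) + γ • ((Z * W_p - P * Z) *ᵥ w) + γ • (P *ᵥ VE)`. -/
theorem value_error_recursion
    {ι : Type*} [Fintype ι] [Nonempty ι]
    (P : Matrix ι ι ℝ) (hP0 : ∀ i j, 0 ≤ P i j) (hP1 : ∀ i, ∑ j, P i j = 1)
    (rbar : ι → ℝ) (γ : ℝ) (hγ0 : 0 ≤ γ) (hγ1 : γ < 1)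
    {k : ℕ} (Z : Matrix ι (Fin k) ℝ) (W_p : Matrix (Fin k) (Fin k) ℝ)
    (w_r w : Fin k → ℝ) (hw : w = w_r + γ • (W_p *ᵥ w))
    (Qπ : ι → ℝ) (hQπ : Qπ = rbar + γ • (P *ᵥ Qπ)) :
    Z *ᵥ w - Qπ =
      (Z *ᵥ w_r - rbar) + γ • ((Z * W_p - P * Z) *ᵥ w) + γ • (P *ᵥ (Z *ᵥ w - Qπ)) := by
  have hZw : Z *ᵥ w = Z *ᵥ w_r + γ • (Z *ᵥ (W_p *ᵥ w)) := by
    conv_lhs => rw [hw]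
    rw [mulVec_add, mulVec_smul]
  conv_lhs => rw [hZw, hQπ]
  rw [sub_mulVec, mulVec_sub, ← mulVec_mulVec, ← mulVec_mulVec]
  module
end

section
/- Let π : S → A → ℝ be a policy (entrywise nonnegative with ∑_a π s a = 1 for each s) that factors through f, i.e., there exists π̂ : Z_S → A → ℝ with π̂ (f s) a = π s a for all s a, and let Q^π : S → A → ℝ satisfy the Bellman equation Q^π s a = r s a + γ * ∑_{s'} p s a s' * (∑_{a'} π s' a' * Q^π s' a'). Then there exists a function Q̂ : Z_SA → ℝ such that Q̂ (g (f s) a) = Q^π s a for all s : S and a : A. -/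
/-- On a finite type, a real function whose oscillation on every fibre of `f` is at most `D` is
within `D` above a function of `f`. -/
theorem exists_le_comp_le_add_of_fiber_osc_le {S Z : Type*} [Finite S] (f : S → Z) (V : S → ℝ)
    {D : ℝ} (h : ∀ x y, f x = f y → V x - V y ≤ D) :
    ∃ m : Z → ℝ, ∀ x, m (f x) ≤ V x ∧ V x ≤ m (f x) + D := by
  refine ⟨fun z => ⨅ y : {y // f y = z}, V y, fun x => ⟨?_, ?_⟩⟩
  · exact ciInf_le (Set.finite_range fun y : {y // f y = f x} => V y).bddBelow ⟨x, rfl⟩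
  · have : Nonempty {y // f y = f x} := ⟨⟨x, rfl⟩⟩
    have : V x - D ≤ ⨅ y : {y // f y = f x}, V y :=
      le_ciInf fun y => by linarith [h x y y.2.symm]
    linarith

/-- If two probability vectors have the same pushforward along `f`, then the corresponding
expectations of `V` differ by at most the oscillation of `V` on the fibres of `f`. -/
theorem expectation_sub_le_of_pushforward_eq {S Z : Type*} [Fintype S] [Fintype Z] [DecidableEq Z]
    (f : S → Z) (V : S → ℝ) {D : ℝ} (h : ∀ x y, f x = f y → V x - V y ≤ D)
    (μ ν : S → ℝ) (hμ0 : ∀ x, 0 ≤ μ x) (hμ1 : ∑ x, μ x = 1) (hν0 : ∀ x, 0 ≤ ν x)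
    (hμν : ∀ z, ∑ x ∈ Finset.univ.filter (fun x => f x = z), μ x =
      ∑ x ∈ Finset.univ.filter (fun x => f x = z), ν x) :
    ∑ x, μ x * V x - ∑ x, ν x * V x ≤ D := by
  obtain ⟨m, hm⟩ := exists_le_comp_le_add_of_fiber_osc_le f V h
  have key (ρ : S → ℝ) : ∑ x, ρ x * m (f x) =
      ∑ z, (∑ x ∈ Finset.univ.filter (fun x => f x = z), ρ x) * m z := by
    rw [← Finset.sum_fiberwise Finset.univ f]
    refine Finset.sum_congr rfl fun z _ => ?_
    rw [Finset.sum_mul]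
    refine Finset.sum_congr rfl fun x hx => ?_
    rw [(Finset.mem_filter.1 hx).2]
  have upper : ∑ x, μ x * V x ≤ ∑ x, μ x * m (f x) + D := by
    calc ∑ x, μ x * V x ≤ ∑ x, μ x * (m (f x) + D) :=
          Finset.sum_le_sum fun x _ => mul_le_mul_of_nonneg_left (hm x).2 (hμ0 x)
      _ = ∑ x, μ x * m (f x) + D := by
          simp only [mul_add, Finset.sum_add_distrib, ← Finset.sum_mul, hμ1, one_mul]
  have lower : ∑ x, ν x * m (f x) ≤ ∑ x, ν x * V x :=
    Finset.sum_le_sum fun x _ => mul_le_mul_of_nonneg_left (hm x).1 (hν0 x)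
  have : ∑ x, μ x * m (f x) = ∑ x, ν x * m (f x) := by
    rw [key, key]
    exact Finset.sum_congr rfl fun z _ => by rw [hμν z]
  linarith


/-- Theorem 3 (policy case): if the reward and transition dynamics factor through the
state–action embedding `(s, a) ↦ g (f s) a` (an MDP homomorphism), then for any policy `π`
that factors through `f`, the value function `Qπ` solving the Bellman equation factors
through the state–action embedding: there is `Qhat : Z_SA → ℝ` with
`Qhat (g (f s) a) = Qπ s a` for all `s a`. -/
theorem value_function_factors_through_homomorphism
    {S A : Type*} [Fintype S] [Nonempty S] [Fintype A] [Nonempty A]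
    {Z_S : Type*} [Fintype Z_S] [DecidableEq Z_S] {Z_SA : Type*}
    (p : S → A → S → ℝ) (hp0 : ∀ s a s', 0 ≤ p s a s')
    (hp1 : ∀ s a, ∑ s', p s a s' = 1)
    (r : S → A → ℝ) (γ : ℝ) (hγ0 : 0 ≤ γ) (hγ1 : γ < 1)
    (f : S → Z_S) (g : Z_S → A → Z_SA)
    (rhat : Z_SA → ℝ) (hrhat : ∀ s a, rhat (g (f s) a) = r s a)
    (phat : Z_SA → Z_S → ℝ)
    (hphat : ∀ s a (z' : Z_S),
      phat (g (f s) a) z' = ∑ s' ∈ Finset.univ.filter (fun s' => f s' = z'), p s a s')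
    (π : S → A → ℝ) (hπ0 : ∀ s a, 0 ≤ π s a) (hπ1 : ∀ s, ∑ a, π s a = 1)
    (πhat : Z_S → A → ℝ) (hπhat : ∀ s a, πhat (f s) a = π s a)
    (Qπ : S → A → ℝ)
    (hQπ : ∀ s a, Qπ s a = r s a + γ * ∑ s', p s a s' * ∑ a', π s' a' * Qπ s' a') :
    ∃ Qhat : Z_SA → ℝ, ∀ s a, Qhat (g (f s) a) = Qπ s a := by
  let F : S × A → Z_SA := fun x => g (f x.1) x.2
  obtain ⟨⟨⟨x₀, y₀⟩, h₀⟩, hmax⟩ : ∃ w₀ : {w : (S × A) × (S × A) // F w.1 = F w.2},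
      ∀ w : {w : (S × A) × (S × A) // F w.1 = F w.2},
        Qπ w.1.1.1 w.1.1.2 - Qπ w.1.2.1 w.1.2.2 ≤
          Qπ w₀.1.1.1 w₀.1.1.2 - Qπ w₀.1.2.1 w₀.1.2.2 := by
    have : Nonempty {w : (S × A) × (S × A) // F w.1 = F w.2} :=
      ⟨⟨(Classical.arbitrary _, Classical.arbitrary _), rfl⟩⟩
    exact Finite.exists_max fun w : {w : (S × A) × (S × A) // F w.1 = F w.2} =>
      Qπ w.1.1.1 w.1.1.2 - Qπ w.1.2.1 w.1.2.2
  set D := Qπ x₀.1 x₀.2 - Qπ y₀.1 y₀.2 with hD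
  have hle (x y : S × A) (hxy : F x = F y) : Qπ x.1 x.2 - Qπ y.1 y.2 ≤ D :=
    hmax ⟨(x, y), hxy⟩
  have hV (s t : S) (hst : f s = f t) :
      ∑ a, π s a * Qπ s a - ∑ a, π t a * Qπ t a ≤ D := by
    have hπ (a : A) : π t a = π s a := by rw [← hπhat, ← hπhat, hst]
    calc ∑ a, π s a * Qπ s a - ∑ a, π t a * Qπ t a
        = ∑ a, π s a * (Qπ s a - Qπ t a) := by
          simp only [hπ, mul_sub, Finset.sum_sub_distrib]
      _ ≤ ∑ a, π s a * D := Finset.sum_le_sum fun a _ =>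
          mul_le_mul_of_nonneg_left (hle (s, a) (t, a) (by simp only [F, hst])) (hπ0 s a)
      _ = D := by rw [← Finset.sum_mul, hπ1, one_mul]
  have hstep := expectation_sub_le_of_pushforward_eq f (fun s => ∑ a, π s a * Qπ s a) hV
    (p x₀.1 x₀.2) (p y₀.1 y₀.2) (hp0 _ _) (hp1 _ _) (hp0 _ _)
    (fun z => by rw [← hphat, ← hphat]; exact congrArg (phat · z) h₀)
  have hr : r x₀.1 x₀.2 = r y₀.1 y₀.2 := by
    rw [← hrhat, ← hrhat]; exact congrArg rhat h₀
  have hcontr : D ≤ γ * D := by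
    have := mul_le_mul_of_nonneg_left hstep hγ0
    rw [mul_sub] at this
    linarith [hQπ x₀.1 x₀.2, hQπ y₀.1 y₀.2]
  have hD0 : D ≤ 0 := by nlinarith
  have hfac : Function.FactorsThrough (fun x : S × A => Qπ x.1 x.2) F := fun x y hxy =>
    le_antisymm (by linarith [hle x y hxy]) (by linarith [hle y x hxy.symm])
  exact ⟨Function.extend F (fun x => Qπ x.1 x.2) 0, fun s a => hfac.extend_apply 0 (s, a)⟩
end

section
/- Let Q* : S → A → ℝ satisfy the Bellman optimality equation Q* s a = r s a + γ * ∑_{s'} p s a s' * (max_{a'} Q* s' a'). Then there exists a function Q̂ : Z_SA → ℝ such that Q̂ (g (f s) a) = Q* s a for all s : S and a : A; that is, the optimal value function factors through the state–action embedding. -/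
/-- If a function on a finite type oscillates by at most `D` on the fibres of `f`, then its
expectations under two probability vectors with the same pushforward along `f` differ by at
most `D`. -/
theorem sum_mul_sub_sum_mul_le_of_fiber_sum_eq {S Z : Type*} [Fintype S] [Fintype Z]
    [DecidableEq Z] (f : S → Z) {u v : S → ℝ} (hu0 : ∀ s, 0 ≤ u s) (hu1 : ∑ s, u s = 1)
    (hv0 : ∀ s, 0 ≤ v s)
    (huv : ∀ z, ∑ s ∈ Finset.univ.filter (fun s => f s = z), u s =
      ∑ s ∈ Finset.univ.filter (fun s => f s = z), v s)
    {V : S → ℝ} {D : ℝ} (hD : ∀ s t, f s = f t → V s - V t ≤ D) :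
    ∑ s, u s * V s - ∑ s, v s * V s ≤ D := by
  let m : Z → ℝ := fun z => ⨅ t : {t // f t = z}, V t
  have hmV (s : S) : m (f s) ≤ V s :=
    ciInf_le (f := fun t : {t // f t = f s} => V t) (Set.finite_range _).bddBelow ⟨s, rfl⟩
  have hVm (s : S) : V s ≤ m (f s) + D := by
    have : Nonempty {t // f t = f s} := ⟨⟨s, rfl⟩⟩
    have : V s - D ≤ m (f s) := le_ciInf fun t => by linarith [hD s t t.2.symm]
    linarith
  have hpush (w : S → ℝ) : ∑ s, w s * m (f s) =
      ∑ z, (∑ s ∈ Finset.univ.filter (fun s => f s = z), w s) * m z := by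
    rw [← Finset.sum_fiberwise Finset.univ f]
    refine Finset.sum_congr rfl fun z _ => ?_
    rw [Finset.sum_mul]
    refine Finset.sum_congr rfl fun s hs => ?_
    rw [(Finset.mem_filter.mp hs).2]
  have hmean : ∑ s, u s * m (f s) = ∑ s, v s * m (f s) := by
    simp only [hpush, huv]
  have hupper : ∑ s, u s * V s ≤ ∑ s, u s * m (f s) + D := calc
    ∑ s, u s * V s ≤ ∑ s, u s * (m (f s) + D) :=
      Finset.sum_le_sum fun s _ => mul_le_mul_of_nonneg_left (hVm s) (hu0 s)
    _ = ∑ s, u s * m (f s) + D := by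
      simp only [mul_add, Finset.sum_add_distrib, ← Finset.sum_mul, hu1, one_mul]
  have hlower : ∑ s, v s * m (f s) ≤ ∑ s, v s * V s :=
    Finset.sum_le_sum fun s _ => mul_le_mul_of_nonneg_left (hmV s) (hv0 s)
  linarith

/-- Theorem 3 (optimality case): if the reward and transition dynamics factor through the
state–action embedding `(s, a) ↦ g (f s) a` (an MDP homomorphism), then the optimal value
function `Qstar` solving the Bellman optimality equation factors through the state–action
embedding: there is `Qhat : Z_SA → ℝ` with `Qhat (g (f s) a) = Qstar s a` for all `s a`. -/
theorem optimal_value_function_factors_through_homomorphism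
    {S A : Type*} [Fintype S] [Nonempty S] [Fintype A] [Nonempty A]
    {Z_S : Type*} [Fintype Z_S] [DecidableEq Z_S] {Z_SA : Type*}
    (p : S → A → S → ℝ) (hp0 : ∀ s a s', 0 ≤ p s a s')
    (hp1 : ∀ s a, ∑ s', p s a s' = 1)
    (r : S → A → ℝ) (γ : ℝ) (hγ0 : 0 ≤ γ) (hγ1 : γ < 1)
    (f : S → Z_S) (g : Z_S → A → Z_SA)
    (rhat : Z_SA → ℝ) (hrhat : ∀ s a, rhat (g (f s) a) = r s a)
    (phat : Z_SA → Z_S → ℝ)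
    (hphat : ∀ s a (z' : Z_S),
      phat (g (f s) a) z' = ∑ s' ∈ Finset.univ.filter (fun s' => f s' = z'), p s a s')
    (Qstar : S → A → ℝ)
    (hQstar : ∀ s a, Qstar s a = r s a + γ * ∑ s', p s a s' * ⨆ a', Qstar s' a') :
    ∃ Qhat : Z_SA → ℝ, ∀ s a, Qhat (g (f s) a) = Qstar s a := by
  let V : S → ℝ := fun s => ⨆ a, Qstar s a
  have contraction {D : ℝ} (hD : ∀ s t, f s = f t → V s - V t ≤ D) {s t : S} {a b : A}
      (hg : g (f s) a = g (f t) b) : Qstar s a - Qstar t b ≤ γ * D := by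
    have hr : r s a = r t b := by rw [← hrhat, ← hrhat, hg]
    have hsum := sum_mul_sub_sum_mul_le_of_fiber_sum_eq f (hp0 s a) (hp1 s a) (hp0 t b)
      (fun z => by rw [← hphat, ← hphat, hg]) hD
    rw [hQstar s a, hQstar t b, hr]
    linarith [mul_le_mul_of_nonneg_left hsum hγ0]
  obtain ⟨⟨s₀, t₀⟩, hmem, hmax⟩ := Finset.exists_max_image
    (Finset.univ.filter fun x : S × S => f x.1 = f x.2) (fun x => V x.1 - V x.2)
    ⟨(Classical.arbitrary S, Classical.arbitrary S), by simp⟩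
  have hst : f s₀ = f t₀ := (Finset.mem_filter.mp hmem).2
  have hD : ∀ s t, f s = f t → V s - V t ≤ V s₀ - V t₀ := fun s t h =>
    hmax (s, t) (Finset.mem_filter.mpr ⟨Finset.mem_univ _, h⟩)
  have hle : V s₀ ≤ V t₀ + γ * (V s₀ - V t₀) := ciSup_le fun a => by
    have h₁ := contraction hD (s := s₀) (t := t₀) (a := a) (b := a) (by rw [hst])
    have h₂ : Qstar t₀ a ≤ V t₀ := le_ciSup (Set.finite_range (Qstar t₀)).bddAbove a
    linarith
  have hD0 : V s₀ - V t₀ ≤ 0 := by nlinarith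
  have hV : ∀ s t, f s = f t → V s - V t ≤ 0 := fun s t h => (hD s t h).trans hD0
  have hfac : Function.FactorsThrough (fun x : S × A => Qstar x.1 x.2)
      (fun x : S × A => g (f x.1) x.2) := fun x y h => by
    have h₁ := contraction hV h
    have h₂ := contraction hV h.symm
    simp only
    linarith
  exact ⟨Function.extend (fun x : S × A => g (f x.1) x.2) (fun x => Qstar x.1 x.2) 0,
    fun s a => hfac.extend_apply 0 (s, a)⟩
end

section
/- Let π : S → A → ℝ be a policy (entrywise nonnegative with ∑_a π s a = 1 for each s) that factors through f via π̂ : Z_S → A → ℝ with π̂ (f s) a = π s a for all s a. Define the finite-horizon value functions Q_0 s a = r s a and Q_{n+1} s a = r s a + γ * ∑_{s'} p s a s' * (∑_{a'} π s' a' * Q_n s' a'), and the latent finite-horizon value functions Q̂_0 z = ρ̂ z and Q̂_{n+1} z = ρ̂ z + γ * ∑_{z' : Z_S} p̂ z z' * (∑_{a'} π̂ z' a' * Q̂_n (g z' a')). Then for every n : ℕ, s : S, and a : A, Q_n s a = Q̂_n (g (f s) a). -/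
/-- Finite-horizon value functions agree with their latent counterparts under an MDP
homomorphism: if `Q 0 = r`, `Q (n+1) s a = r s a + γ * ∑ s', p s a s' * ∑ a', π s' a' * Q n s' a'`,
and `Qhat 0 = rhat`,
`Qhat (n+1) z = rhat z + γ * ∑ z', phat z z' * ∑ a', πhat z' a' * Qhat n (g z' a')`,
then `Q n s a = Qhat n (g (f s) a)` for all `n s a`. -/
theorem finite_horizon_value_factors_through_homomorphism
    {S A : Type*} [Fintype S] [Nonempty S] [Fintype A] [Nonempty A]
    {Z_S : Type*} [Fintype Z_S] [DecidableEq Z_S] {Z_SA : Type*}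
    (p : S → A → S → ℝ) (hp0 : ∀ s a s', 0 ≤ p s a s')
    (hp1 : ∀ s a, ∑ s', p s a s' = 1)
    (r : S → A → ℝ) (γ : ℝ) (hγ0 : 0 ≤ γ) (hγ1 : γ < 1)
    (f : S → Z_S) (g : Z_S → A → Z_SA)
    (rhat : Z_SA → ℝ) (hrhat : ∀ s a, rhat (g (f s) a) = r s a)
    (phat : Z_SA → Z_S → ℝ)
    (hphat : ∀ s a (z' : Z_S),
      phat (g (f s) a) z' = ∑ s' ∈ Finset.univ.filter (fun s' => f s' = z'), p s a s')
    (π : S → A → ℝ) (hπ0 : ∀ s a, 0 ≤ π s a) (hπ1 : ∀ s, ∑ a, π s a = 1)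
    (πhat : Z_S → A → ℝ) (hπhat : ∀ s a, πhat (f s) a = π s a)
    (Q : ℕ → S → A → ℝ)
    (hQ0 : ∀ s a, Q 0 s a = r s a)
    (hQsucc : ∀ n s a,
      Q (n + 1) s a = r s a + γ * ∑ s', p s a s' * ∑ a', π s' a' * Q n s' a')
    (Qhat : ℕ → Z_SA → ℝ)
    (hQhat0 : ∀ z, Qhat 0 z = rhat z)
    (hQhatsucc : ∀ n (z : Z_SA),
      Qhat (n + 1) z = rhat z + γ * ∑ z' : Z_S, phat z z' * ∑ a', πhat z' a' * Qhat n (g z' a')) :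
    ∀ (n : ℕ) (s : S) (a : A), Q n s a = Qhat n (g (f s) a) := by
  intro n
  induction n with
  | zero => intro s a; rw [hQ0, hQhat0, hrhat]
  | succ n ih =>
    intro s a
    rw [hQsucc, hQhatsucc, hrhat]
    congr 2
    rw [← Finset.sum_fiberwise Finset.univ f]
    refine Finset.sum_congr rfl fun z' _ => ?_
    rw [hphat, Finset.sum_mul]
    refine Finset.sum_congr rfl fun s' hs' => ?_
    obtain rfl := (Finset.mem_filter.mp hs').2
    simp only [hπhat, ih]
end

section
/- Define the finite-horizon optimal value functions Q*_0 s a = r s a and Q*_{n+1} s a = r s a + γ * ∑_{s'} p s a s' * (max_{a'} Q*_n s' a'), and the latent finite-horizon optimal value functions Q̂*_0 z = ρ̂ z and Q̂*_{n+1} z = ρ̂ z + γ * ∑_{z' : Z_S} p̂ z z' * (max_{a'} Q̂*_n (g z' a')). Then for every n : ℕ, s : S, and a : A, Q*_n s a = Q̂*_n (g (f s) a). -/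
/-- Finite-horizon optimal value functions agree with their latent counterparts under an
MDP homomorphism: if `Qstar 0 = r`,
`Qstar (n+1) s a = r s a + γ * ∑ s', p s a s' * max_{a'} Qstar n s' a'`, and
`Qshat 0 = rhat`, `Qshat (n+1) z = rhat z + γ * ∑ z', phat z z' * max_{a'} Qshat n (g z' a')`,
then `Qstar n s a = Qshat n (g (f s) a)` for all `n s a`. -/
theorem finite_horizon_optimal_value_factors_through_homomorphism
    {S A : Type*} [Fintype S] [Nonempty S] [Fintype A] [Nonempty A]
    {Z_S : Type*} [Fintype Z_S] [DecidableEq Z_S] {Z_SA : Type*}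
    (p : S → A → S → ℝ) (hp0 : ∀ s a s', 0 ≤ p s a s')
    (hp1 : ∀ s a, ∑ s', p s a s' = 1)
    (r : S → A → ℝ) (γ : ℝ) (hγ0 : 0 ≤ γ) (hγ1 : γ < 1)
    (f : S → Z_S) (g : Z_S → A → Z_SA)
    (rhat : Z_SA → ℝ) (hrhat : ∀ s a, rhat (g (f s) a) = r s a)
    (phat : Z_SA → Z_S → ℝ)
    (hphat : ∀ s a (z' : Z_S),
      phat (g (f s) a) z' = ∑ s' ∈ Finset.univ.filter (fun s' => f s' = z'), p s a s')
    (Qstar : ℕ → S → A → ℝ)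
    (hQ0 : ∀ s a, Qstar 0 s a = r s a)
    (hQsucc : ∀ n s a,
      Qstar (n + 1) s a = r s a + γ * ∑ s', p s a s' * ⨆ a', Qstar n s' a')
    (Qshat : ℕ → Z_SA → ℝ)
    (hQhat0 : ∀ z, Qshat 0 z = rhat z)
    (hQhatsucc : ∀ n (z : Z_SA),
      Qshat (n + 1) z = rhat z + γ * ∑ z' : Z_S, phat z z' * ⨆ a', Qshat n (g z' a')) :
    ∀ (n : ℕ) (s : S) (a : A), Qstar n s a = Qshat n (g (f s) a) := by
  intro n
  induction n with
  | zero => intro s a; rw [hQ0, hQhat0, hrhat]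
  | succ n ih =>
    intro s a
    rw [hQsucc, hQhatsucc, hrhat]
    simp_rw [hphat, ih, Finset.sum_mul]
    congr 2
    rw [← Finset.sum_fiberwise Finset.univ f]
    refine Finset.sum_congr rfl fun z' _ => Finset.sum_congr rfl fun s' hs' => ?_
    rw [(Finset.mem_filter.mp hs').2]
end
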